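/- Let 𝒜 be a σ-algebra of subsets of T, μ : 𝒜 → [0,∞) a non-negative, monotone, integrable set function with μ(∅) = 0 and with integral function Ψ(A) = ∫_A μ, X a Banach space, and F : T → cwk(X) a bounded multifunction. Then F is Birkhoff simple integrable with respect to μ if and only if F is Birkhoff simple integrable with respect to Ψ, with the same integral; likewise, F is Gould integrable with respect to μ if and only if F is Gould integrable with respect to Ψ, with the same integral. -/

import Mathlib

open scoped Pointwise
open Metric Filter

/-- A finite partition of `S` by nonempty, pairwise disjoint members of `𝒜`. -/
def IsFinPart {T : Type*} (𝒜 : Set (Set T)) (S : Set T) {n : ℕ} (A : Fin n → Set T) : Prop :=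
  (∀ i, A i ∈ 𝒜) ∧ (∀ i, (A i).Nonempty) ∧
    (Pairwise fun i j => Disjoint (A i) (A j)) ∧ (⋃ i, A i) = S

/-- A countable partition of `S` by nonempty, pairwise disjoint members of `𝒜`. -/
def IsCtblPart {T : Type*} (𝒜 : Set (Set T)) (S : Set T) (A : ℕ → Set T) : Prop :=
  (∀ n, A n ∈ 𝒜) ∧ (∀ n, (A n).Nonempty) ∧
    (Pairwise fun i j => Disjoint (A i) (A j)) ∧ (⋃ n, A n) = S

/-- The set function `μ` is (Gould) integrable on `S` with integral `l`. -/
def SetFnIntegrableOn {T : Type*} (𝒜 : Set (Set T)) (μ : Set T → ℝ) (S : Set T) (l : ℝ) : Prop :=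
  ∀ ε > (0 : ℝ), ∃ (n : ℕ) (P₀ : Fin n → Set T), IsFinPart 𝒜 S P₀ ∧
    ∀ (m : ℕ) (P : Fin m → Set T), IsFinPart 𝒜 S P → (∀ j, ∃ i, P j ⊆ P₀ i) →
      |(∑ j, μ (P j)) - l| ≤ ε

/-- The multifunction `F` is Gould integrable with respect to `ν`, with integral `I`. -/
def GouldOn {T X : Type*} [NormedAddCommGroup X] [NormedSpace ℝ X]
    (𝒜 : Set (Set T)) (ν : Set T → ℝ) (S : Set T) (F : T → Set X) (I : Set X) : Prop :=
  ∀ ε > (0 : ℝ), ∃ (n : ℕ) (P₀ : Fin n → Set T), IsFinPart 𝒜 S P₀ ∧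
    ∀ (m : ℕ) (P : Fin m → Set T), IsFinPart 𝒜 S P → (∀ j, ∃ i, P j ⊆ P₀ i) →
      ∀ t : Fin m → T, (∀ j, t j ∈ P j) →
        hausdorffDist (closure (∑ j, ν (P j) • F (t j))) I < ε

/-- The multifunction `F` is Birkhoff simple integrable with respect to `ν`,
with integral the closed set `I`. -/
def BirkhoffSimpleOn {T X : Type*} [NormedAddCommGroup X] [NormedSpace ℝ X]
    (𝒜 : Set (Set T)) (ν : Set T → ℝ) (S : Set T) (F : T → Set X) (I : Set X) : Prop :=
  ∀ ε > (0 : ℝ), ∃ P₀ : ℕ → Set T, IsCtblPart 𝒜 S P₀ ∧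
    ∀ P : ℕ → Set T, IsCtblPart 𝒜 S P → (∀ n, ∃ m, P n ⊆ P₀ m) →
      ∀ t : ℕ → T, (∀ n, t n ∈ P n) →
        limsup (fun n => hausdorffDist
          (closure (∑ i ∈ Finset.range n, ν (P i) • F (t i))) I) atTop ≤ ε

section Hausdorff

variable {ι X : Type*} [NormedAddCommGroup X] [NormedSpace ℝ X]

theorem exists_mem_sum_smul_dist_le (s : Finset ι) (a b : ι → ℝ) (A : ι → Set X) {M : ℝ}
    (hM : ∀ i, ∀ x ∈ A i, ‖x‖ ≤ M) {x : X} (hx : x ∈ ∑ i ∈ s, a i • A i) :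
    ∃ y ∈ ∑ i ∈ s, b i • A i, dist x y ≤ M * ∑ i ∈ s, |a i - b i| := by
  classical
  obtain ⟨g, hg, rfl⟩ := (Set.mem_finsetSum _ _ _).1 hx
  have hf : ∀ i, ∃ f, i ∈ s → f ∈ A i ∧ a i • f = g i := fun i => by
    by_cases hi : i ∈ s
    · obtain ⟨f, hf, e⟩ := Set.mem_smul_set.1 (hg hi)
      exact ⟨f, fun _ => ⟨hf, e⟩⟩
    · exact ⟨0, fun h => absurd h hi⟩
  choose f hf using hf
  refine ⟨∑ i ∈ s, b i • f i,
    (Set.mem_finsetSum _ _ _).2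
      ⟨fun i => b i • f i, fun hi => Set.smul_mem_smul_set (hf _ hi).1, rfl⟩, ?_⟩
  rw [dist_eq_norm, ← Finset.sum_sub_distrib, Finset.mul_sum]
  refine norm_sum_le_of_le _ fun i hi => ?_
  rw [← (hf i hi).2, ← sub_smul, norm_smul, Real.norm_eq_abs, mul_comm]
  exact mul_le_mul_of_nonneg_right (hM i _ (hf i hi).1) (abs_nonneg _)

theorem nonempty_sum_smul (s : Finset ι) (a : ι → ℝ) (A : ι → Set X)
    (hne : ∀ i, (A i).Nonempty) : (∑ i ∈ s, a i • A i).Nonempty := by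
  choose f hf using hne
  exact ⟨∑ i ∈ s, a i • f i,
    (Set.mem_finsetSum _ _ _).2 ⟨fun i => a i • f i, fun _ => Set.smul_mem_smul_set (hf _), rfl⟩⟩

theorem isBounded_sum_smul (s : Finset ι) (a : ι → ℝ) (A : ι → Set X) {M : ℝ}
    (hM : ∀ i, ∀ x ∈ A i, ‖x‖ ≤ M) : Bornology.IsBounded (∑ i ∈ s, a i • A i) := by
  refine isBounded_iff_forall_norm_le.2 ⟨M * ∑ i ∈ s, |a i - 0|, fun x hx => ?_⟩
  obtain ⟨y, hy, hxy⟩ := exists_mem_sum_smul_dist_le s a (fun _ => 0) A hM hx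
  obtain ⟨g, hg, rfl⟩ := (Set.mem_finsetSum _ _ _).1 hy
  have h0 : ∑ i ∈ s, g i = 0 := Finset.sum_eq_zero fun i hi => by
    obtain ⟨f, -, e⟩ := Set.mem_smul_set.1 (hg hi)
    simpa using e.symm
  rwa [h0, dist_zero_right] at hxy

/-- Changing the weights of a weighted sum of uniformly bounded sets moves it, in Hausdorff
distance, by at most a multiple of the total change of the weights. -/
theorem hausdorffDist_sum_smul_le (s : Finset ι) (a b : ι → ℝ) (A : ι → Set X) {M : ℝ}
    (hM0 : 0 ≤ M) (hM : ∀ i, ∀ x ∈ A i, ‖x‖ ≤ M) (hne : ∀ i, (A i).Nonempty)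
    {I : Set X} :
    hausdorffDist (closure (∑ i ∈ s, a i • A i)) I ≤
      hausdorffDist (closure (∑ i ∈ s, b i • A i)) I + M * ∑ i ∈ s, |a i - b i| := by
  rw [hausdorffDist_closure₁, hausdorffDist_closure₁, add_comm]
  have h : hausdorffDist (∑ i ∈ s, a i • A i) (∑ i ∈ s, b i • A i) ≤ M * ∑ i ∈ s, |a i - b i| := by
    refine hausdorffDist_le_of_mem_dist
      (mul_nonneg hM0 (Finset.sum_nonneg fun _ _ => abs_nonneg _))
      (fun x hx => exists_mem_sum_smul_dist_le s a b A hM hx) fun x hx => ?_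
    simpa only [abs_sub_comm] using exists_mem_sum_smul_dist_le s b a A hM hx
  exact (hausdorffDist_triangle (hausdorffEDist_ne_top_of_nonempty_of_bounded
    (nonempty_sum_smul s a A hne) (nonempty_sum_smul s b A hne)
    (isBounded_sum_smul s a A hM) (isBounded_sum_smul s b A hM))).trans (by gcongr)

end Hausdorff

/-- Real sequences at bounded distance have `limsup`s at bounded distance; if one is unbounded
above, so is the other, and both `limsup`s take the value `0`. -/
theorem limsup_le_add_of_le_add {u v : ℕ → ℝ} {c ε : ℝ} (hc : 0 ≤ c) (hε : 0 ≤ ε)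
    (hv0 : ∀ n, 0 ≤ v n) (hvu : ∀ n, v n ≤ u n + c) (huv : ∀ n, u n ≤ v n + c)
    (hu : limsup u atTop ≤ ε) : limsup v atTop ≤ ε + c := by
  by_cases hb : IsBoundedUnder (· ≤ ·) atTop u
  · refine le_of_forall_pos_le_add fun δ hδ => ?_
    have hlt : ∀ᶠ n in atTop, u n < ε + δ := eventually_lt_of_limsup_lt (by linarith) hb
    refine limsup_le_of_le (isCoboundedUnder_le_of_le atTop hv0) ?_
    filter_upwards [hlt] with n hn
    linarith [hvu n]
  · have hempty : {a | ∀ᶠ n in atTop, v n ≤ a} = ∅ := by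
      refine Set.eq_empty_of_forall_notMem fun a (ha : ∀ᶠ n in atTop, v n ≤ a) => hb ?_
      refine isBoundedUnder_of_eventually_le (a := a + c) ?_
      filter_upwards [ha] with n hn
      linarith [huv n]
    rw [limsup_eq, hempty, Real.sInf_empty]
    positivity

section Partition

variable {T : Type*}

/-- Discarding the empty members of a finite disjoint cover yields a finite partition. -/
theorem exists_isFinPart_sum_eq {𝒜 : Set (Set T)} {S : Set T} {ι : Type*} [Fintype ι]
    (A : ι → Set T) (hA : ∀ i, A i ∈ 𝒜) (hd : Pairwise fun i j => Disjoint (A i) (A j))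
    (hU : (⋃ i, A i) = S) :
    ∃ (m : ℕ) (P : Fin m → Set T), IsFinPart 𝒜 S P ∧ (∀ j, ∃ i, P j = A i) ∧
      ∀ f : Set T → ℝ, f ∅ = 0 → ∑ j, f (P j) = ∑ i, f (A i) := by
  classical
  let e := Fintype.equivFin {i // (A i).Nonempty}
  refine ⟨_, fun j => A (e.symm j), ⟨fun j => hA _, fun j => (e.symm j).2, fun i j hij => ?_, ?_⟩,
    fun j => ⟨_, rfl⟩, fun f hf => ?_⟩
  · exact hd fun h => hij (e.symm.injective (Subtype.ext h))
  · rw [← hU]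
    refine Set.Subset.antisymm (Set.iUnion_subset fun j => Set.subset_iUnion A _) fun x hx => ?_
    obtain ⟨i, hi⟩ := Set.mem_iUnion.1 hx
    exact Set.mem_iUnion.2 ⟨e ⟨i, ⟨x, hi⟩⟩, by simpa using hi⟩
  · rw [e.symm.sum_comp fun i => f (A i),
      ← Finset.sum_subtype (Finset.univ.filter fun i => (A i).Nonempty) (by simp) fun i => f (A i)]
    refine Finset.sum_subset (Finset.subset_univ _) fun i _ hi => ?_
    have hempty : A i = ∅ := Set.not_nonempty_iff_eq_empty.1 fun h => hi (by simpa using h)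
    rw [hempty, hf]

variable [MeasurableSpace T]

theorem exists_isFinPart_common_refinement {m n : ℕ} {P : Fin m → Set T} {Q : Fin n → Set T}
    (hP : IsFinPart {A | MeasurableSet A} Set.univ P)
    (hQ : IsFinPart {A | MeasurableSet A} Set.univ Q) :
    ∃ (k : ℕ) (R : Fin k → Set T), IsFinPart {A | MeasurableSet A} Set.univ R ∧
      (∀ l, ∃ i, R l ⊆ P i) ∧ ∀ l, ∃ j, R l ⊆ Q j := by
  have hd : Pairwise fun p q : Fin m × Fin n => Disjoint (P p.1 ∩ Q p.2) (P q.1 ∩ Q q.2) := by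
    intro p q hpq
    by_cases h : p.1 = q.1
    · exact (hQ.2.2.1 fun h' => hpq (Prod.ext h h')).mono Set.inter_subset_right
        Set.inter_subset_right
    · exact (hP.2.2.1 h).mono Set.inter_subset_left Set.inter_subset_left
  have hU : (⋃ p : Fin m × Fin n, P p.1 ∩ Q p.2) = Set.univ := by
    refine Set.eq_univ_of_forall fun x => ?_
    obtain ⟨i, hi⟩ := Set.mem_iUnion.1 (hP.2.2.2 ▸ Set.mem_univ x)
    obtain ⟨j, hj⟩ := Set.mem_iUnion.1 (hQ.2.2.2 ▸ Set.mem_univ x)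
    exact Set.mem_iUnion.2 ⟨(i, j), hi, hj⟩
  obtain ⟨k, R, hR, hRA, -⟩ := exists_isFinPart_sum_eq (𝒜 := {A | MeasurableSet A}) _
    (fun p : Fin m × Fin n => MeasurableSet.inter (hP.1 p.1) (hQ.1 p.2)) hd hU
  refine ⟨k, R, hR, fun l => ?_, fun l => ?_⟩
  · obtain ⟨p, hp⟩ := hRA l
    exact ⟨p.1, hp ▸ Set.inter_subset_left⟩
  · obtain ⟨p, hp⟩ := hRA l
    exact ⟨p.2, hp ▸ Set.inter_subset_right⟩

theorem exists_isCtblPart_common_refinement {n : ℕ} {P : ℕ → Set T} {Q : Fin n → Set T}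
    (hP : IsCtblPart {A | MeasurableSet A} Set.univ P)
    (hQ : IsFinPart {A | MeasurableSet A} Set.univ Q) :
    ∃ R : ℕ → Set T, IsCtblPart {A | MeasurableSet A} Set.univ R ∧
      (∀ l, ∃ i, R l ⊆ P i) ∧ ∀ l, ∃ j, R l ⊆ Q j := by
  have hcover : ∀ x, ∃ p : ℕ × Fin n, x ∈ P p.1 ∩ Q p.2 := fun x => by
    obtain ⟨i, hi⟩ := Set.mem_iUnion.1 (hP.2.2.2 ▸ Set.mem_univ x)
    obtain ⟨j, hj⟩ := Set.mem_iUnion.1 (hQ.2.2.2 ▸ Set.mem_univ x)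
    exact ⟨(i, j), hi, hj⟩
  let S := {p : ℕ × Fin n // (P p.1 ∩ Q p.2).Nonempty}
  have hsurj : Function.Surjective fun p : S => p.1.1 := fun i => by
    obtain ⟨x, hx⟩ := hP.2.1 i
    obtain ⟨j, hj⟩ := Set.mem_iUnion.1 (hQ.2.2.2 ▸ Set.mem_univ x)
    exact ⟨⟨(i, j), x, hx, hj⟩, rfl⟩
  have : Infinite S := Infinite.of_surjective _ hsurj
  obtain ⟨e⟩ := nonempty_equiv_of_countable (α := ℕ) (β := S)
  refine ⟨fun l => P (e l).1.1 ∩ Q (e l).1.2, ⟨fun l => MeasurableSet.inter (hP.1 _) (hQ.1 _),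
    fun l => (e l).2, fun k l hkl => ?_, ?_⟩, fun l => ⟨_, Set.inter_subset_left⟩,
    fun l => ⟨_, Set.inter_subset_right⟩⟩
  · by_cases h : (e k).1.1 = (e l).1.1
    · exact (hQ.2.2.1 fun h' => hkl (e.injective (Subtype.ext (Prod.ext h h')))).mono
        Set.inter_subset_right Set.inter_subset_right
    · exact (hP.2.2.1 h).mono Set.inter_subset_left Set.inter_subset_left
  · refine Set.eq_univ_of_forall fun x => ?_
    obtain ⟨p, hp⟩ := hcover x
    exact Set.mem_iUnion.2 ⟨e.symm ⟨p, x, hp⟩, by simpa using hp⟩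

/-- The set functions `ν` and `ν'` differ by little in total variation on families of disjoint
sets subordinate to a fine enough finite partition. -/
def VariationallyClose (ν ν' : Set T → ℝ) : Prop :=
  ∀ ε > (0 : ℝ), ∃ (n : ℕ) (P₀ : Fin n → Set T), IsFinPart {A | MeasurableSet A} Set.univ P₀ ∧
    ∀ (m : ℕ) (B : Fin m → Set T), (∀ i, MeasurableSet (B i)) →
      (Pairwise fun i j => Disjoint (B i) (B j)) → (∀ i, ∃ k, B i ⊆ P₀ k) →
        ∑ i, |ν (B i) - ν' (B i)| ≤ ε

theorem VariationallyClose.symm {ν ν' : Set T → ℝ} (h : VariationallyClose ν ν') :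
    VariationallyClose ν' ν := by
  simpa only [VariationallyClose, abs_sub_comm] using h

/-- A set function is variationally close to its integral function (Henstock's lemma). -/
theorem variationallyClose_integral {μ Ψ : Set T → ℝ} (hμ0 : μ ∅ = 0)
    (hΨ : ∀ A, MeasurableSet A → SetFnIntegrableOn {A | MeasurableSet A} μ A (Ψ A)) :
    VariationallyClose μ Ψ := by
  classical
  intro ε hε
  obtain ⟨n, P₀, hP₀, hP⟩ := hΨ Set.univ MeasurableSet.univ (ε / 3) (by positivity)
  refine ⟨n, P₀, hP₀, fun m B hB hBd hBP => ?_⟩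
  have hfam : ∀ D : Fin m → Σ k : ℕ, (Fin k → Set T),
      (∀ i j, MeasurableSet ((D i).2 j)) →
      (∀ i, Pairwise fun j k => Disjoint ((D i).2 j) ((D i).2 k)) →
      (∀ i, (⋃ j, (D i).2 j) = B i) →
      |(∑ k, μ (P₀ k \ ⋃ i, B i) + ∑ i, ∑ j, μ ((D i).2 j)) - Ψ Set.univ| ≤ ε / 3 := by
    intro D hDm hDd hDU
    have hsub : ∀ i j, (D i).2 j ⊆ B i := fun i j => hDU i ▸ Set.subset_iUnion (D i).2 j
    let A : Fin n ⊕ (Σ i, Fin (D i).1) → Set T :=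
      Sum.elim (fun k => P₀ k \ ⋃ i, B i) fun p => (D p.1).2 p.2
    have hAm : ∀ a, MeasurableSet (A a) := by
      rintro (k | p)
      · exact MeasurableSet.diff (hP₀.1 k) (MeasurableSet.iUnion hB)
      · exact hDm _ _
    have hmix : ∀ k p, Disjoint (A (Sum.inl k)) (A (Sum.inr p)) := fun k p =>
      Set.disjoint_left.2 fun x hx hx' => hx.2 (Set.mem_iUnion.2 ⟨p.1, hsub _ _ hx'⟩)
    have hAd : Pairwise fun a b => Disjoint (A a) (A b) := by
      rintro (k | ⟨i, p⟩) (l | ⟨j, q⟩) hkl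
      · exact (hP₀.2.2.1 (ne_of_apply_ne Sum.inl hkl)).mono Set.sdiff_subset Set.sdiff_subset
      · exact hmix k _
      · exact (hmix l _).symm
      · by_cases h : i = j
        · subst h
          refine hDd i fun h => hkl ?_
          simpa using h
        · exact (hBd h).mono (hsub _ _) (hsub _ _)
    have hAU : (⋃ a, A a) = Set.univ := by
      refine Set.eq_univ_of_forall fun x => ?_
      by_cases hx : x ∈ ⋃ i, B i
      · obtain ⟨i, hi⟩ := Set.mem_iUnion.1 hx
        rw [← hDU i] at hi
        obtain ⟨j, hj⟩ := Set.mem_iUnion.1 hi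
        exact Set.mem_iUnion.2 ⟨Sum.inr ⟨i, j⟩, hj⟩
      · obtain ⟨k, hk⟩ := Set.mem_iUnion.1 (hP₀.2.2.2 ▸ Set.mem_univ x)
        exact Set.mem_iUnion.2 ⟨Sum.inl k, hk, hx⟩
    obtain ⟨k, R, hR, hRA, hRsum⟩ :=
      exists_isFinPart_sum_eq (𝒜 := {A | MeasurableSet A}) A hAm hAd hAU
    have hle := hP k R hR fun l => by
      obtain ⟨p | p, hp⟩ := hRA l
      · exact ⟨p, hp ▸ Set.sdiff_subset⟩
      · obtain ⟨q, hq⟩ := hBP p.1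
        exact ⟨q, hp ▸ (hsub _ _).trans hq⟩
    rw [hRsum μ hμ0, Fintype.sum_sum_type, Fintype.sum_sigma] at hle
    exact hle
  have hC : ∀ i, ∃ C : Σ k : ℕ, (Fin k → Set T), IsFinPart {A | MeasurableSet A} (B i) C.2 ∧
      |(∑ j, μ (C.2 j)) - Ψ (B i)| ≤ ε / 3 / (m + 1) := fun i => by
    obtain ⟨k, C, hC, h⟩ := hΨ (B i) (hB i) (ε / 3 / (m + 1)) (by positivity)
    exact ⟨⟨k, C⟩, hC, h k C hC fun j => ⟨j, subset_rfl⟩⟩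
  choose C hC hCΨ using hC
  -- Keep `B i` when `p i` holds, and replace it by the pieces of `C i` otherwise.
  have hkeep : ∀ (p : Fin m → Prop) [DecidablePred p], |(∑ k, μ (P₀ k \ ⋃ i, B i) +
      ∑ i, if p i then μ (B i) else ∑ j, μ ((C i).2 j)) - Ψ Set.univ| ≤ ε / 3 := by
    intro p _
    have hD : ∀ i, ∃ D : Σ k : ℕ, (Fin k → Set T), (∀ j, MeasurableSet (D.2 j)) ∧
        (Pairwise fun j k => Disjoint (D.2 j) (D.2 k)) ∧ (⋃ j, D.2 j) = B i ∧
        ∑ j, μ (D.2 j) = if p i then μ (B i) else ∑ j, μ ((C i).2 j) := fun i => by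
      split_ifs
      · exact ⟨⟨1, fun _ => B i⟩, fun _ => hB i, fun j k hjk => absurd (Subsingleton.elim j k) hjk,
          Set.iUnion_const _, by simp⟩
      · exact ⟨C i, (hC i).1, (hC i).2.2.1, (hC i).2.2.2, rfl⟩
    choose D hDm hDd hDU hDsum using hD
    simpa only [hDsum] using hfam D hDm hDd hDU
  have habs : ∑ i, |μ (B i) - ∑ j, μ ((C i).2 j)| ≤ ε / 3 + ε / 3 := by
    let p : Fin m → Prop := fun i => ∑ j, μ ((C i).2 j) ≤ μ (B i)
    have h₁ := (abs_le.1 (hkeep p)).2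
    have h₂ := (abs_le.1 (hkeep fun i => ¬ p i)).1
    have h₃ : ∑ i, |μ (B i) - ∑ j, μ ((C i).2 j)| =
        (∑ i, if p i then μ (B i) else ∑ j, μ ((C i).2 j)) -
          ∑ i, if ¬ p i then μ (B i) else ∑ j, μ ((C i).2 j) := by
      rw [← Finset.sum_sub_distrib]
      refine Finset.sum_congr rfl fun i _ => ?_
      by_cases hi : p i
      · rw [if_pos hi, if_neg (not_not.2 hi), abs_of_nonneg (sub_nonneg.2 hi)]
      · rw [if_neg hi, if_pos hi, abs_of_neg (sub_neg.2 (not_le.1 hi)), neg_sub]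
    linarith
  have hsmall : ∑ i : Fin m, |(∑ j, μ ((C i).2 j)) - Ψ (B i)| ≤ ε / 3 := by
    refine (Finset.sum_le_sum fun i _ => hCΨ i).trans ?_
    rw [Finset.sum_const, Finset.card_univ, Fintype.card_fin, nsmul_eq_mul, mul_div_assoc',
      div_le_iff₀ (by positivity)]
    nlinarith
  calc ∑ i, |μ (B i) - Ψ (B i)|
      ≤ ∑ i, (|μ (B i) - ∑ j, μ ((C i).2 j)| + |(∑ j, μ ((C i).2 j)) - Ψ (B i)|) :=
        Finset.sum_le_sum fun i _ => abs_sub_le _ _ _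
    _ ≤ ε := by rw [Finset.sum_add_distrib]; linarith

variable {X : Type*} [NormedAddCommGroup X] [NormedSpace ℝ X] {ν ν' : Set T → ℝ}
  {F : T → Set X} {M : ℝ} {I : Set X}

theorem VariationallyClose.gouldOn (h : VariationallyClose ν ν') (hM0 : 0 ≤ M)
    (hFne : ∀ t, (F t).Nonempty) (hM : ∀ t, ∀ x ∈ F t, ‖x‖ ≤ M)
    (hG : GouldOn {A | MeasurableSet A} ν Set.univ F I) :
    GouldOn {A | MeasurableSet A} ν' Set.univ F I := by
  intro ε hε
  obtain ⟨_, P, hP, hPν⟩ := hG (ε / 2) (by positivity)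
  obtain ⟨_, Q, hQ, hQν⟩ := h (ε / 2 / (M + 1)) (by positivity)
  obtain ⟨k, R, hR, hRP, hRQ⟩ := exists_isFinPart_common_refinement hP hQ
  refine ⟨k, R, hR, fun m A hA hAR t ht => ?_⟩
  have h₁ := hPν m A hA (fun j => ?_) t ht
  · have h₂ := hQν m A hA.1 hA.2.2.1 fun j => ?_
    · have h₃ := hausdorffDist_sum_smul_le Finset.univ (fun j => ν' (A j)) (fun j => ν (A j))
        (fun j => F (t j)) hM0 (fun j => hM _) (fun j => hFne _) (I := I)
      have h₄ : M * ∑ j, |ν' (A j) - ν (A j)| ≤ ε / 2 := by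
        simp only [abs_sub_comm (ν' _)]
        rw [le_div_iff₀ (by positivity)] at h₂
        nlinarith [Finset.sum_nonneg fun j (_ : j ∈ Finset.univ) => abs_nonneg (ν (A j) - ν' (A j))]
      linarith
    · obtain ⟨l, hl⟩ := hAR j
      exact (hRQ l).imp fun _ => hl.trans
  · obtain ⟨l, hl⟩ := hAR j
    exact (hRP l).imp fun _ => hl.trans

theorem VariationallyClose.birkhoffSimpleOn (h : VariationallyClose ν ν') (hM0 : 0 ≤ M)
    (hFne : ∀ t, (F t).Nonempty) (hM : ∀ t, ∀ x ∈ F t, ‖x‖ ≤ M)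
    (hG : BirkhoffSimpleOn {A | MeasurableSet A} ν Set.univ F I) :
    BirkhoffSimpleOn {A | MeasurableSet A} ν' Set.univ F I := by
  intro ε hε
  obtain ⟨P, hP, hPν⟩ := hG (ε / 2) (by positivity)
  obtain ⟨_, Q, hQ, hQν⟩ := h (ε / 2 / (M + 1)) (by positivity)
  obtain ⟨R, hR, hRP, hRQ⟩ := exists_isCtblPart_common_refinement hP hQ
  refine ⟨R, hR, fun A hA hAR t ht => ?_⟩
  have h₁ := hPν A hA (fun j => ?_) t ht
  · have h₂ : ∀ n, M * ∑ i ∈ Finset.range n, |ν (A i) - ν' (A i)| ≤ ε / 2 := fun n => by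
      have h₃ := hQν n (fun i => A i) (fun i => hA.1 i)
        (fun i j hij => hA.2.2.1 fun h => hij (Fin.ext h)) fun i => by
          obtain ⟨l, hl⟩ := hAR i
          exact (hRQ l).imp fun _ => hl.trans
      rw [Fin.sum_univ_eq_sum_range (fun i => |ν (A i) - ν' (A i)|) n,
        le_div_iff₀ (by positivity)] at h₃
      nlinarith [Finset.sum_nonneg fun j (_ : j ∈ Finset.range n) =>
        abs_nonneg (ν (A j) - ν' (A j))]
    rw [← add_halves ε]
    refine limsup_le_add_of_le_add (by positivity) (by positivity) (fun n => hausdorffDist_nonneg)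
      (fun n => ?_) (fun n => ?_) h₁
    · refine (hausdorffDist_sum_smul_le _ _ (fun i => ν (A i)) _ hM0 (fun j => hM _)
        fun j => hFne _).trans (add_le_add_right ?_ _)
      simpa only [abs_sub_comm] using h₂ n
    · exact (hausdorffDist_sum_smul_le _ _ (fun i => ν' (A i)) _ hM0 (fun j => hM _)
        fun j => hFne _).trans (add_le_add_right (h₂ n) _)
  · obtain ⟨l, hl⟩ := hAR j
    exact (hRP l).imp fun _ => hl.trans

end Partition

/-- A bounded `cwk(X)`-valued multifunction is simple-Birkhoff (resp. Gould) integrable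
with respect to an integrable monotone set function `μ` if and only if it is so with
respect to the integral function `Ψ` of `μ`, with the same integral. -/
theorem birkhoffSimple_and_gould_wrt_mu_iff_wrt_Psi
    {T X : Type*} [Nonempty T] [NormedAddCommGroup X] [NormedSpace ℝ X] [CompleteSpace X]
    (𝒜 : Set (Set T)) (μ : Set T → ℝ)
    (h𝒜empty : ∅ ∈ 𝒜) (h𝒜univ : Set.univ ∈ 𝒜)
    (h𝒜compl : ∀ A ∈ 𝒜, Aᶜ ∈ 𝒜)
    (h𝒜iUnion : ∀ A : ℕ → Set T, (∀ n, A n ∈ 𝒜) → (⋃ n, A n) ∈ 𝒜)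
    (hμ0 : μ ∅ = 0) (hμnn : ∀ A ∈ 𝒜, 0 ≤ μ A)
    (hμmono : ∀ A ∈ 𝒜, ∀ B ∈ 𝒜, A ⊆ B → μ A ≤ μ B)
    (Ψ : Set T → ℝ) (hΨ : ∀ A ∈ 𝒜, SetFnIntegrableOn 𝒜 μ A (Ψ A))
    (F : T → Set X) (hFne : ∀ t, (F t).Nonempty)
    (hFconv : ∀ t, Convex ℝ (F t))
    (hFwk : ∀ t, IsCompact (toWeakSpace ℝ X '' F t))
    (M : ℝ) (hM : ∀ t, ∀ x ∈ F t, ‖x‖ ≤ M)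
    (I : Set X) (hIne : I.Nonempty) (hIcl : IsClosed I) (hIbd : Bornology.IsBounded I) :
    (BirkhoffSimpleOn 𝒜 μ Set.univ F I ↔ BirkhoffSimpleOn 𝒜 Ψ Set.univ F I) ∧
    (GouldOn 𝒜 μ Set.univ F I ↔ GouldOn 𝒜 Ψ Set.univ F I) := by
  let _ : MeasurableSpace T := ⟨(· ∈ 𝒜), h𝒜empty, h𝒜compl, h𝒜iUnion⟩
  have hclose : VariationallyClose μ Ψ := variationallyClose_integral hμ0 hΨ
  have hM0 : 0 ≤ M := by
    obtain ⟨t⟩ := ‹Nonempty T›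
    obtain ⟨x, hx⟩ := hFne t
    exact (norm_nonneg x).trans (hM t x hx)
  exact ⟨⟨hclose.birkhoffSimpleOn hM0 hFne hM, hclose.symm.birkhoffSimpleOn hM0 hFne hM⟩,
    hclose.gouldOn hM0 hFne hM, hclose.symm.gouldOn hM0 hFne hM⟩
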